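/- Assume the AG₂ setup and the definition of the rational functions a_τ (for τ/2 ∈ G₂) below, with κ_τ = 3 for τ ∈ {±2β₁, ±2β₂, ±2β₃} and κ_τ = 1 for τ ∈ {±2α₁, ±2α₂, ±2α₃}. Fix x ∈ ℂ² and natural numbers n_γ ≥ 0 for γ ∈ G₂₊; let N = ∑_{γ∈G₂₊} n_γ, A(z) = ∏_{γ∈G₂₊} ⟨γ,z⟩^{n_γ}, and μ(x) = ∑_{τ : τ/2 ∈ G₂} κ_τ(exp⟨x,τ⟩ − 1). Then there exist polynomials u, v ∈ ℂ[z₁,z₂] with v ≠ 0 and total degree of u at most (total degree of v) + N − 2, such that for every D₁-regular z with v(z) ≠ 0 and ⟨γ,z⟩ ≠ 0 for all γ ∈ G₂₊: ∑_{τ : τ/2 ∈ G₂} a_τ(z)·(A(z+τ)·exp⟨x,τ⟩ − A(z)) − μ(x)·A(z) = ∑_{γ∈G₂₊} (n_γ − m_γ − m_{2γ}) · ( ∑_{τ : τ/2 ∈ G₂} κ_τ⟨τ,γ⟩·exp⟨x,τ⟩ ) · A(z)/⟨γ,z⟩ + u(z)/v(z). -/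

import Mathlib

noncomputable section

open Complex

/-- The bilinear extension of the Euclidean inner product on `ℂ²`. -/
def bil (z w : Fin 2 → ℂ) : ℂ := z 0 * w 0 + z 1 * w 1

/-- `√3` as a complex number. -/
def rt3 : ℂ := (Real.sqrt 3 : ℝ)

def vα₁ : Fin 2 → ℂ := ![0, rt3]
def vα₂ : Fin 2 → ℂ := ![-(3/2), rt3 / 2]
def vα₃ : Fin 2 → ℂ := ![3/2, rt3 / 2]
def vβ₁ : Fin 2 → ℂ := ![1, 0]
def vβ₂ : Fin 2 → ℂ := ![1/2, rt3 / 2]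
def vβ₃ : Fin 2 → ℂ := ![-(1/2), rt3 / 2]

/-- Positive roots of `G₂`: `α₁, α₂, α₃, β₁, β₂, β₃`. -/
def G2plus : List (Fin 2 → ℂ) := [vα₁, vα₂, vα₃, vβ₁, vβ₂, vβ₃]
/-- The six short roots `±βᵢ` of `G₂`. -/
def shortRoots : List (Fin 2 → ℂ) := [vβ₁, vβ₂, vβ₃, -vβ₁, -vβ₂, -vβ₃]
/-- The six long roots `±αᵢ` of `G₂`. -/
def longRoots : List (Fin 2 → ℂ) := [vα₁, vα₂, vα₃, -vα₁, -vα₂, -vα₃]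
/-- All twelve roots of `G₂`. -/
def G2all : List (Fin 2 → ℂ) := longRoots ++ shortRoots
/-- The twelve vectors `2γ`, `γ ∈ G₂`. -/
def twoG2 : List (Fin 2 → ℂ) := G2all.map (fun γ => (2 : ℂ) • γ)
/-- The six vectors `±2βⱼ`. -/
def twoShort : List (Fin 2 → ℂ) := shortRoots.map (fun γ => (2 : ℂ) • γ)
/-- The six vectors `±2αⱼ`. -/
def twoLong : List (Fin 2 → ℂ) := longRoots.map (fun γ => (2 : ℂ) • γ)
/-- The six vectors `±4βⱼ`. -/
def fourShort : List (Fin 2 → ℂ) := shortRoots.map (fun γ => (4 : ℂ) • γ)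
/-- The eighteen vectors `2γ`, `γ ∈ AG₂`. -/
def twoAG2 : List (Fin 2 → ℂ) := twoG2 ++ fourShort

/-- The quasi-invariance conditions for the configuration `AG₂` with
multiplicities `m_{αᵢ} = m`, `m_{βᵢ} = 3m`, `m_{2βᵢ} = 1`. -/
def QuasiInvAG2 (m : ℕ) (ψ : (Fin 2 → ℂ) → ℂ) : Prop :=
  (∀ α ∈ [vα₁, vα₂, vα₃], ∀ s : ℕ, 1 ≤ s → s ≤ m →
    ∀ z : Fin 2 → ℂ, bil α z = 0 →
      ψ (z + (s : ℂ) • α) = ψ (z - (s : ℂ) • α)) ∧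
  (∀ β ∈ [vβ₁, vβ₂, vβ₃], ∀ s : ℕ, ((1 ≤ s ∧ s ≤ 3 * m) ∨ s = 3 * m + 2) →
    ∀ z : Fin 2 → ℂ, bil β z = 0 →
      ψ (z + (s : ℂ) • β) = ψ (z - (s : ℂ) • β))

/-- The linear form `z ↦ ⟨γ, z⟩` as a polynomial in `z₁, z₂`. -/
def linForm (γ : Fin 2 → ℂ) : MvPolynomial (Fin 2) ℂ :=
  MvPolynomial.C (γ 0) * MvPolynomial.X 0 + MvPolynomial.C (γ 1) * MvPolynomial.X 1

/-- The highest-order term `∏ᵢ ⟨αᵢ,z⟩^m ⟨βᵢ,z⟩^{3m} ⟨2βᵢ,z⟩` of the polynomial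
part of the Baker–Akhiezer function for `AG₂`. -/
def topTerm (m : ℕ) : MvPolynomial (Fin 2) ℂ :=
  (linForm vα₁ * linForm vα₂ * linForm vα₃) ^ m *
    (linForm vβ₁ * linForm vβ₂ * linForm vβ₃) ^ (3 * m) *
    (linForm ((2 : ℂ) • vβ₁) * linForm ((2 : ℂ) • vβ₂) * linForm ((2 : ℂ) • vβ₃))

/-- A Baker–Akhiezer function for `AG₂` at `x`. -/
def IsBAFunction (m : ℕ) (x : Fin 2 → ℂ) (ψ : (Fin 2 → ℂ) → ℂ) : Prop :=
  ∃ P : MvPolynomial (Fin 2) ℂ,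
    P.totalDegree = 12 * m + 3 ∧
    MvPolynomial.homogeneousComponent (12 * m + 3) P = topTerm m ∧
    (∀ z, ψ z = MvPolynomial.eval z P * Complex.exp (bil z x)) ∧
    QuasiInvAG2 m ψ

/-- `z` is `D₁`-regular: `⟨γ,z⟩ ∉ {0, ±γ², ±2γ²}` for every `γ ∈ G₂₊`. -/
def D1Reg (z : Fin 2 → ℂ) : Prop :=
  ∀ γ ∈ G2plus, bil γ z ≠ 0 ∧ bil γ z ≠ bil γ γ ∧ bil γ z ≠ -bil γ γ ∧
    bil γ z ≠ 2 * bil γ γ ∧ bil γ z ≠ -(2 * bil γ γ)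

open scoped Classical in
/-- The coefficient functions `a_τ` (for `τ/2 ∈ G₂`) of the dual
Macdonald–Ruijsenaars operator `D₁` for `AG₂`. -/
noncomputable def aD1 (m : ℕ) (τ z : Fin 2 → ℂ) : ℂ :=
  let h : Fin 2 → ℂ := (2⁻¹ : ℂ) • τ
  if τ ∈ twoShort then
    3 *
      ((shortRoots.filter (fun γ => bil τ γ = bil γ γ)).map (fun γ =>
        (1 - (3 * (m : ℂ) + 2) * bil γ γ / bil γ z) *
        (1 + 3 * (m : ℂ) * bil γ γ / (bil γ z + 2 * bil γ γ)) *
        (1 - (3 * (m : ℂ) - 1) * bil γ γ / (bil γ z - bil γ γ)))).prod *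
      ((longRoots.filter (fun γ => bil τ γ = bil γ γ)).map (fun γ =>
        1 - (m : ℂ) * bil γ γ / bil γ z)).prod *
      ((1 - (3 * (m : ℂ) + 2) * bil h h / bil h z) *
        (1 - 3 * (m : ℂ) * bil h h / (bil h z + bil h h)))
  else
    ((shortRoots.filter (fun γ => bil τ γ = 3 * bil γ γ)).map (fun γ =>
        (1 - (3 * (m : ℂ) + 2) * bil γ γ / bil γ z) *
        (1 - (3 * (m : ℂ) + 1) * bil γ γ / (bil γ z + bil γ γ)) *
        (1 - 3 * (m : ℂ) * bil γ γ / (bil γ z + 2 * bil γ γ)))).prod *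
      ((longRoots.filter (fun γ => bil τ γ = bil γ γ)).map (fun γ =>
        1 - (m : ℂ) * bil γ γ / bil γ z)).prod *
      ((1 - (m : ℂ) * bil h h / bil h z) *
        (1 - (m : ℂ) * bil h h / (bil h z + bil h h)))

/-- The value `D₁p(z) = ∑_{τ : τ/2 ∈ G₂} a_τ(z)(p(z+τ) − p(z))`. -/
noncomputable def applyD1 (m : ℕ) (p : (Fin 2 → ℂ) → ℂ) (z : Fin 2 → ℂ) : ℂ :=
  (twoG2.map (fun τ => aD1 m τ z * (p (z + τ) - p z))).sum

/-- The ring `R^a_{AG₂}` of analytic quasi-invariants for `AG₂`. -/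
def RaAG2 (m : ℕ) (p : (Fin 2 → ℂ) → ℂ) : Prop :=
  (∀ z, AnalyticAt ℂ p z) ∧ QuasiInvAG2 m p

open scoped Classical in
/-- The constant `κ_τ`: `3` for `τ = ±2βⱼ` and `1` for `τ = ±2αⱼ`. -/
noncomputable def kap (τ : Fin 2 → ℂ) : ℂ := if τ ∈ twoShort then 3 else 1

open scoped Classical in
/-- `m_γ + m_{2γ}` for `γ ∈ G₂₊`: equals `3m+1` for short roots `βᵢ`
and `m` for long roots `αᵢ`. -/
noncomputable def multSum (m : ℕ) (γ : Fin 2 → ℂ) : ℕ :=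
  if γ ∈ [vβ₁, vβ₂, vβ₃] then 3 * m + 1 else m

/-- The sum `∑_{τ : τ/2 ∈ G₂} κ_τ ⟨τ,γ⟩ exp⟨x,τ⟩`. -/
noncomputable def cSum (x γ : Fin 2 → ℂ) : ℂ :=
  (twoG2.map (fun τ => kap τ * bil τ γ * Complex.exp (bil x τ))).sum

/-- The eigenvalue `μ(x) = ∑_{τ : τ/2 ∈ G₂} κ_τ (exp⟨x,τ⟩ − 1)` of `D₁`. -/
noncomputable def muD1 (x : Fin 2 → ℂ) : ℂ :=
  (twoG2.map (fun τ => kap τ * (Complex.exp (bil x τ) - 1))).sum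

open MvPolynomial in
/-- `f` agrees with a rational function of degree at most `k` off a curve. -/
def RO (k : ℤ) (f : (Fin 2 → ℂ) → ℂ) : Prop :=
  ∃ u v : MvPolynomial (Fin 2) ℂ, v ≠ 0 ∧ (u.totalDegree : ℤ) ≤ v.totalDegree + k ∧
    ∀ z, eval z v ≠ 0 → f z = eval z u / eval z v

theorem RO.congr {k : ℤ} {f g : (Fin 2 → ℂ) → ℂ} (hf : RO k f)
    (w : MvPolynomial (Fin 2) ℂ) (hw : w ≠ 0)
    (h : ∀ z, MvPolynomial.eval z w ≠ 0 → g z = f z) : RO k g := by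
  obtain ⟨u, v, hv, hd, he⟩ := hf
  refine ⟨u * w, v * w, mul_ne_zero hv hw, ?_, ?_⟩
  · have := MvPolynomial.totalDegree_mul u w
    rw [MvPolynomial.totalDegree_mul_of_isDomain hv hw]
    push_cast
    omega
  · intro z hz
    rw [map_mul] at hz
    have h1 := left_ne_zero_of_mul hz
    have h2 := right_ne_zero_of_mul hz
    rw [h z h2, he z h1, map_mul, map_mul, mul_div_mul_right _ _ h2]

theorem RO.of_eq {k : ℤ} {f g : (Fin 2 → ℂ) → ℂ} (hf : RO k f)
    (h : ∀ z, g z = f z) : RO k g := hf.congr 1 one_ne_zero (fun z _ => h z)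

theorem RO.mono {k l : ℤ} {f : (Fin 2 → ℂ) → ℂ} (hf : RO k f) (h : k ≤ l) : RO l f := by
  obtain ⟨u, v, hv, hd, he⟩ := hf
  exact ⟨u, v, hv, by omega, he⟩

theorem RO.mul {k l : ℤ} {f g : (Fin 2 → ℂ) → ℂ} (hf : RO k f) (hg : RO l g) :
    RO (k + l) (fun z => f z * g z) := by
  obtain ⟨u, v, hv, hd, he⟩ := hf
  obtain ⟨u', v', hv', hd', he'⟩ := hg
  refine ⟨u * u', v * v', mul_ne_zero hv hv', ?_, ?_⟩
  · have := MvPolynomial.totalDegree_mul u u'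
    rw [MvPolynomial.totalDegree_mul_of_isDomain hv hv']
    push_cast
    omega
  · intro z hz
    rw [map_mul] at hz
    have h1 := left_ne_zero_of_mul hz
    have h2 := right_ne_zero_of_mul hz
    simp only [he z h1, he' z h2, map_mul]
    rw [div_mul_div_comm]

theorem RO.add {k : ℤ} {f g : (Fin 2 → ℂ) → ℂ} (hf : RO k f) (hg : RO k g) :
    RO k (fun z => f z + g z) := by
  obtain ⟨u, v, hv, hd, he⟩ := hf
  obtain ⟨u', v', hv', hd', he'⟩ := hg
  refine ⟨u * v' + v * u', v * v', mul_ne_zero hv hv', ?_, ?_⟩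
  · have h1 := MvPolynomial.totalDegree_mul u v'
    have h2 := MvPolynomial.totalDegree_mul v u'
    have h3 := MvPolynomial.totalDegree_add (u * v') (v * u')
    rw [MvPolynomial.totalDegree_mul_of_isDomain hv hv']
    push_cast
    omega
  · intro z hz
    rw [map_mul] at hz
    have h1 := left_ne_zero_of_mul hz
    have h2 := right_ne_zero_of_mul hz
    simp only [he z h1, he' z h2, map_mul, map_add]
    rw [div_add_div _ _ h1 h2]

theorem RO.const (c : ℂ) : RO 0 (fun _ => c) :=
  ⟨MvPolynomial.C c, 1, one_ne_zero, by simp, by simp⟩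

theorem RO.zero (k : ℤ) : RO k (fun _ => 0) := by
  refine ⟨0, MvPolynomial.X 0 ^ k.natAbs, pow_ne_zero _ (MvPolynomial.X_ne_zero _), ?_, by simp⟩
  rw [MvPolynomial.totalDegree_X_pow, MvPolynomial.totalDegree_zero]
  omega

theorem RO.smul {k : ℤ} {f : (Fin 2 → ℂ) → ℂ} (c : ℂ) (hf : RO k f) :
    RO k (fun z => c * f z) := by
  simpa using (RO.const c).mul hf

theorem RO.list_sum {k : ℤ} {ι : Type} (l : List ι) (F : ι → (Fin 2 → ℂ) → ℂ)
    (h : ∀ i ∈ l, RO k (F i)) : RO k (fun z => (l.map (fun i => F i z)).sum) := by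
  induction l with
  | nil => simpa using RO.zero k
  | cons a l ih =>
    simp only [List.map_cons, List.sum_cons]
    exact (h a (by simp)).add (ih (fun i hi => h i (by simp [hi])))

theorem eval_linForm (γ z : Fin 2 → ℂ) : MvPolynomial.eval z (linForm γ) = bil γ z := by
  simp [linForm, bil]

theorem eval_lin (γ z : Fin 2 → ℂ) (d : ℂ) :
    MvPolynomial.eval z (linForm γ + MvPolynomial.C d) = bil γ z + d := by
  simp [eval_linForm]

theorem coeff_lin (γ : Fin 2 → ℂ) (d : ℂ) (i : Fin 2) :
    MvPolynomial.coeff (Finsupp.single i 1) (linForm γ + MvPolynomial.C d) = γ i := by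
  classical
  fin_cases i <;>
    simp [linForm, MvPolynomial.coeff_C, MvPolynomial.coeff_C_mul, MvPolynomial.coeff_X,
      Finsupp.single_left_inj, eq_comm] <;>
    exact fun h => absurd (DFunLike.congr_fun h 1) (by simp)

theorem lin_ne (γ : Fin 2 → ℂ) (hγ : γ ≠ 0) (d : ℂ) : linForm γ + MvPolynomial.C d ≠ 0 := by
  intro h
  apply hγ
  funext i
  rw [← coeff_lin γ d i, h]
  simp

theorem lin_deg (γ : Fin 2 → ℂ) (hγ : γ ≠ 0) (d : ℂ) :
    1 ≤ (linForm γ + MvPolynomial.C d).totalDegree := by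
  obtain ⟨i, hi⟩ := Function.ne_iff.1 hγ
  have := MvPolynomial.le_totalDegree (p := linForm γ + MvPolynomial.C d)
    (s := Finsupp.single i 1) (by
      rw [MvPolynomial.mem_support_iff, coeff_lin]; exact hi)
  simpa using this

theorem RO.lin (γ : Fin 2 → ℂ) : RO 1 (fun z => bil γ z) := by
  refine ⟨linForm γ, 1, one_ne_zero, ?_, by simp [eval_linForm]⟩
  have h3 : (linForm γ).totalDegree ≤ 1 := by
    unfold linForm
    refine (MvPolynomial.totalDegree_add _ _).trans (max_le ?_ ?_) <;>
    · refine (MvPolynomial.totalDegree_mul _ _).trans ?_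
      simp
  simpa using h3

theorem RO.inv (γ : Fin 2 → ℂ) (hγ : γ ≠ 0) (d : ℂ) : RO (-1) (fun z => (bil γ z + d)⁻¹) := by
  refine ⟨1, linForm γ + MvPolynomial.C d, lin_ne γ hγ d, ?_, ?_⟩
  · have := lin_deg γ hγ d
    simp
    omega
  · intro z _
    rw [eval_lin]
    simp

theorem RO.pow {f : (Fin 2 → ℂ) → ℂ} (hf : RO 1 f) (n : ℕ) : RO n (fun z => f z ^ n) := by
  induction n with
  | zero => simpa using RO.const 1
  | succ n ih =>
    simp only [pow_succ]
    simpa using ih.mul hf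

theorem RO.list_pow (l : List (Fin 2 → ℂ)) (n : (Fin 2 → ℂ) → ℕ) :
    RO ((l.map n).sum : ℕ) (fun z => (l.map (fun γ => bil γ z ^ n γ)).prod) := by
  induction l with
  | nil => simpa using RO.const 1
  | cons a l ih =>
    simp only [List.map_cons, List.prod_cons, List.sum_cons]
    have := ((RO.lin a).pow (n a)).mul ih
    simpa using this

/-- `f = 1 + l + O(-2)` with `l = O(-1)`. -/
def PE (f l : (Fin 2 → ℂ) → ℂ) : Prop := RO (-1) l ∧ RO (-2) (fun z => f z - 1 - l z)

theorem PE.of_eq {f l f' l' : (Fin 2 → ℂ) → ℂ} (h : PE f l) (hf : ∀ z, f' z = f z)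
    (hl : ∀ z, l' z = l z) : PE f' l' :=
  ⟨h.1.of_eq hl, h.2.of_eq (fun z => by rw [hf, hl])⟩

theorem PE.mul {f l g k : (Fin 2 → ℂ) → ℂ} (hf : PE f l) (hg : PE g k) :
    PE (fun z => f z * g z) (fun z => l z + k z) := by
  obtain ⟨h1, h2⟩ := hf
  obtain ⟨h3, h4⟩ := hg
  refine ⟨h1.add h3, ?_⟩
  have a1 : RO (-2) (fun z => l z * k z) := h1.mul h3
  have one := RO.const 1
  have b1 : RO 0 (fun z => 1 + l z) := one.add (h1.mono (by norm_num))
  have b2 : RO 0 (fun z => (1 + k z) + (g z - 1 - k z)) :=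
    (one.add (h3.mono (by norm_num))).add (h4.mono (by norm_num))
  have a2 := h2.mul b2
  have a3 := h4.mul b1
  refine ((a1.add a2).add a3).of_eq (fun z => ?_)
  ring

theorem PE.one : PE (fun _ => 1) (fun _ => 0) :=
  ⟨RO.zero _, by simpa using RO.zero _⟩

theorem PE.pow {f l : (Fin 2 → ℂ) → ℂ} (hf : PE f l) (n : ℕ) :
    PE (fun z => f z ^ n) (fun z => n * l z) := by
  induction n with
  | zero => simpa using PE.one
  | succ n ih =>
    refine (ih.mul hf).of_eq (fun z => pow_succ _ _) (fun z => ?_)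
    push_cast
    ring

theorem PE.list (L : List (Fin 2 → ℂ)) (F G : (Fin 2 → ℂ) → (Fin 2 → ℂ) → ℂ)
    (h : ∀ i ∈ L, PE (F i) (G i)) :
    PE (fun z => (L.map (fun i => F i z)).prod) (fun z => (L.map (fun i => G i z)).sum) := by
  induction L with
  | nil => simpa using PE.one
  | cons a L ih =>
    simp only [List.map_cons, List.prod_cons, List.sum_cons]
    exact (h a (by simp)).mul (ih (fun i hi => h i (by simp [hi])))

/-- The basic factor. -/
theorem PE.fac (γ : Fin 2 → ℂ) (hγ : γ ≠ 0) (c d : ℂ) :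
    PE (fun z => 1 + c / (bil γ z + d)) (fun z => c / bil γ z) := by
  have h0 : RO (-1) (fun z => (bil γ z)⁻¹) := by simpa using RO.inv γ hγ 0
  have hd := RO.inv γ hγ d
  refine ⟨(h0.smul c).of_eq (fun z => div_eq_mul_inv _ _), ?_⟩
  refine ((h0.mul hd).smul (-(c * d))).congr
    ((linForm γ + MvPolynomial.C 0) * (linForm γ + MvPolynomial.C d))
    (mul_ne_zero (lin_ne γ hγ 0) (lin_ne γ hγ d)) (fun z hz => ?_)
  rw [map_mul, eval_lin, eval_lin, add_zero] at hz
  have h1 := left_ne_zero_of_mul hz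
  have h2 := right_ne_zero_of_mul hz
  field_simp
  ring

theorem rt3_sq : rt3 * rt3 = 3 := by
  unfold rt3
  rw [← Complex.ofReal_mul, Real.mul_self_sqrt (by norm_num)]
  norm_num

theorem short_ne : ∀ γ ∈ shortRoots, γ ≠ 0 := by
  intro γ hγ h
  have h0 := congrFun h 0
  simp only [shortRoots, List.mem_cons, List.not_mem_nil, or_false] at hγ
  rcases hγ with rfl | rfl | rfl | rfl | rfl | rfl <;>
    simp [vβ₁, vβ₂, vβ₃] at h0

theorem rt3_ne : rt3 ≠ 0 := by
  intro h
  have := rt3_sq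
  simp [h] at this

theorem long_ne : ∀ γ ∈ longRoots, γ ≠ 0 := by
  intro γ hγ h
  have h0 := congrFun h 1
  simp only [longRoots, List.mem_cons, List.not_mem_nil, or_false] at hγ
  rcases hγ with rfl | rfl | rfl | rfl | rfl | rfl <;>
    simp [vα₁, vα₂, vα₃, rt3_ne] at h0

theorem G2plus_ne : ∀ γ ∈ G2plus, γ ≠ 0 := by
  intro γ hγ
  simp only [G2plus, List.mem_cons, List.not_mem_nil, or_false] at hγ
  rcases hγ with rfl | rfl | rfl | rfl | rfl | rfl
  · exact long_ne _ (by simp [longRoots])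
  · exact long_ne _ (by simp [longRoots])
  · exact long_ne _ (by simp [longRoots])
  · exact short_ne _ (by simp [shortRoots])
  · exact short_ne _ (by simp [shortRoots])
  · exact short_ne _ (by simp [shortRoots])

open scoped Classical in
/-- The first order term of `a_τ / κ_τ`. -/
def lead (m : ℕ) (τ z : Fin 2 → ℂ) : ℂ :=
  let h : Fin 2 → ℂ := (2⁻¹ : ℂ) • τ
  if τ ∈ twoShort then
      ((shortRoots.filter (fun γ => bil τ γ = bil γ γ)).map (fun γ =>
        -(3 * (m : ℂ) + 1) * bil γ γ / bil γ z)).sum +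
      ((longRoots.filter (fun γ => bil τ γ = bil γ γ)).map (fun γ =>
        - (m : ℂ) * bil γ γ / bil γ z)).sum +
      (-(6 * (m : ℂ) + 2) * bil h h / bil h z)
  else
    ((shortRoots.filter (fun γ => bil τ γ = 3 * bil γ γ)).map (fun γ =>
        -(9 * (m : ℂ) + 3) * bil γ γ / bil γ z)).sum +
      ((longRoots.filter (fun γ => bil τ γ = bil γ γ)).map (fun γ =>
        - (m : ℂ) * bil γ γ / bil γ z)).sum +
      (- (2 * (m : ℂ)) * bil h h / bil h z)

theorem mem_two {τ : Fin 2 → ℂ} (h : τ ∈ twoG2) : (2⁻¹ : ℂ) • τ ≠ 0 := by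
  simp only [twoG2, List.mem_map] at h
  obtain ⟨γ, hγ, rfl⟩ := h
  rw [smul_smul]
  norm_num
  rcases List.mem_append.1 hγ with h | h
  · exact long_ne γ h
  · exact short_ne γ h

theorem aD1_PE (m : ℕ) (τ : Fin 2 → ℂ) (hτ : τ ∈ twoG2) :
    ∃ p, (∀ z, aD1 m τ z = kap τ * p z) ∧ PE p (lead m τ) := by
  classical
  have hh := mem_two hτ
  by_cases hs : τ ∈ twoShort
  · refine ⟨fun z => aD1 m τ z / 3, fun z => by simp [kap, hs]; ring, ?_⟩
    have e1 := PE.list (shortRoots.filter (fun γ => bil τ γ = bil γ γ)) _ _ (fun γ hγ =>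
      have h0 := short_ne γ (List.mem_of_mem_filter hγ)
      ((PE.fac γ h0 (-((3 * (m : ℂ) + 2) * bil γ γ)) 0).mul
        (PE.fac γ h0 (3 * (m : ℂ) * bil γ γ) (2 * bil γ γ))).mul
        (PE.fac γ h0 (-((3 * (m : ℂ) - 1) * bil γ γ)) (- bil γ γ)))
    have e2 := PE.list (longRoots.filter (fun γ => bil τ γ = bil γ γ)) _ _ (fun γ hγ =>
      have h0 := long_ne γ (List.mem_of_mem_filter hγ)
      PE.fac γ h0 (-((m : ℂ) * bil γ γ)) 0)
    set h := (2⁻¹ : ℂ) • τ with hdef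
    have e3 := (PE.fac h hh (-((3 * (m : ℂ) + 2) * bil h h)) 0).mul
      (PE.fac h hh (-(3 * (m : ℂ) * bil h h)) (bil h h))
    refine ((e1.mul e2).mul e3).of_eq (fun z => ?_) (fun z => ?_)
    · simp only [aD1, hs, if_true, ← hdef, add_zero, neg_div, ← sub_eq_add_neg]
      ring
    · simp only [lead, hs, if_true, ← hdef]
      congr 1
      · congr 1
        · congr 1
          apply List.map_congr_left
          intro γ _
          ring
        · congr 1
          apply List.map_congr_left
          intro γ _
          ring
      · ring
  · refine ⟨fun z => aD1 m τ z, fun z => by simp [kap, hs], ?_⟩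
    have e1 := PE.list (shortRoots.filter (fun γ => bil τ γ = 3 * bil γ γ)) _ _ (fun γ hγ =>
      have h0 := short_ne γ (List.mem_of_mem_filter hγ)
      ((PE.fac γ h0 (-((3 * (m : ℂ) + 2) * bil γ γ)) 0).mul
        (PE.fac γ h0 (-((3 * (m : ℂ) + 1) * bil γ γ)) (bil γ γ))).mul
        (PE.fac γ h0 (-(3 * (m : ℂ) * bil γ γ)) (2 * bil γ γ)))
    have e2 := PE.list (longRoots.filter (fun γ => bil τ γ = bil γ γ)) _ _ (fun γ hγ =>
      have h0 := long_ne γ (List.mem_of_mem_filter hγ)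
      PE.fac γ h0 (-((m : ℂ) * bil γ γ)) 0)
    set h := (2⁻¹ : ℂ) • τ with hdef
    have e3 := (PE.fac h hh (-((m : ℂ) * bil h h)) 0).mul
      (PE.fac h hh (-((m : ℂ) * bil h h)) (bil h h))
    refine ((e1.mul e2).mul e3).of_eq (fun z => ?_) (fun z => ?_)
    · simp only [aD1, hs, if_false, ← hdef, add_zero, neg_div, ← sub_eq_add_neg]
    · simp only [lead, hs, if_false, ← hdef]
      congr 1
      · congr 1
        · congr 1
          apply List.map_congr_left
          intro γ _
          ring
        · congr 1
          apply List.map_congr_left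
          intro γ _
          ring
      · ring

theorem bil_neg_left (a b : Fin 2 → ℂ) : bil (-a) b = - bil a b := by
  simp [bil]; ring
theorem bil_neg_right (a b : Fin 2 → ℂ) : bil a (-b) = - bil a b := by
  simp [bil]; ring
theorem bil_smul_left (c : ℂ) (a b : Fin 2 → ℂ) : bil (c • a) b = c * bil a b := by
  simp [bil]; ring
theorem bil_smul_right (c : ℂ) (a b : Fin 2 → ℂ) : bil a (c • b) = c * bil a b := by
  simp [bil]; ring
theorem bil_add_right (a b c : Fin 2 → ℂ) : bil a (b + c) = bil a b + bil a c := by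
  simp [bil]; ring

/-- Roots in integer coordinates. -/
def VV (a b : ℤ) : Fin 2 → ℂ := ![(a : ℂ) / 2, b * rt3 / 2]

theorem bil_VV (a b c d : ℤ) : bil (VV a b) (VV c d) = ((a * c + 3 * (b * d) : ℤ) : ℂ) / 4 := by
  simp only [bil, VV, Matrix.cons_val_zero, Matrix.cons_val_one]
  push_cast
  linear_combination (b * d / 4 : ℂ) * rt3_sq

theorem neg_VV (a b : ℤ) : - VV a b = VV (-a) (-b) := by
  funext i
  fin_cases i <;> simp [VV] <;> ring

theorem two_VV (a b : ℤ) : (2 : ℂ) • VV a b = VV (2 * a) (2 * b) := by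
  funext i
  fin_cases i <;> simp [VV] <;> ring

theorem VV_inj (a b c d : ℤ) : VV a b = VV c d ↔ a = c ∧ b = d := by
  constructor
  · intro h
    have h0 := congrFun h 0
    have h1 := congrFun h 1
    simp [VV, rt3_ne] at h0 h1
    exact ⟨h0, h1⟩
  · rintro ⟨rfl, rfl⟩
    rfl

theorem a1 : vα₁ = VV 0 2 := by
  funext i
  fin_cases i <;> simp [VV, vα₁]
theorem a2 : vα₂ = VV (-3) 1 := by
  funext i
  fin_cases i <;> simp [VV, vα₂]; ring
theorem a3 : vα₃ = VV 3 1 := by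
  funext i
  fin_cases i <;> simp [VV, vα₃]
theorem b1 : vβ₁ = VV 2 0 := by
  funext i
  fin_cases i <;> simp [VV, vβ₁]
theorem b2 : vβ₂ = VV 1 1 := by
  funext i
  fin_cases i <;> simp [VV, vβ₂]
theorem b3 : vβ₃ = VV (-1) 1 := by
  funext i
  fin_cases i <;> simp [VV, vβ₃]; ring

theorem half_VV (a b : ℤ) : (2⁻¹ : ℂ) • VV (2 * a) (2 * b) = VV a b := by
  rw [← two_VV, smul_smul]
  norm_num

theorem twoShort_VV : twoShort = [VV (2 * 2) (2 * 0), VV (2 * 1) (2 * 1), VV (2 * (-1)) (2 * 1),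
    VV (2 * (-2)) (2 * 0), VV (2 * (-1)) (2 * (-1)), VV (2 * 1) (2 * (-1))] := by
  simp [twoShort, shortRoots, b1, b2, b3, neg_VV, two_VV]

theorem twoG2_VV : twoG2 = [VV (2 * 0) (2 * 2), VV (2 * (-3)) (2 * 1), VV (2 * 3) (2 * 1),
    VV (2 * 0) (2 * (-2)), VV (2 * 3) (2 * (-1)), VV (2 * (-3)) (2 * (-1)),
    VV (2 * 2) (2 * 0), VV (2 * 1) (2 * 1), VV (2 * (-1)) (2 * 1),
    VV (2 * (-2)) (2 * 0), VV (2 * (-1)) (2 * (-1)), VV (2 * 1) (2 * (-1))] := by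
  simp [twoG2, G2all, longRoots, shortRoots, a1, a2, a3, b1, b2, b3, neg_VV, two_VV]

theorem lead_eq (m : ℕ) (τ : Fin 2 → ℂ) (hτ : τ ∈ twoG2) (z : Fin 2 → ℂ) :
    lead m τ z = -(G2plus.map (fun γ => (multSum m γ : ℂ) * (bil τ γ / bil γ z))).sum := by
  classical
  have n1 : bil (VV 0 (-2)) z = - bil (VV 0 2) z := by rw [← bil_neg_left, neg_VV]; rfl
  have n2 : bil (VV 3 (-1)) z = - bil (VV (-3) 1) z := by rw [← bil_neg_left, neg_VV]; rfl
  have n3 : bil (VV (-3) (-1)) z = - bil (VV 3 1) z := by rw [← bil_neg_left, neg_VV]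
  have n4 : bil (VV (-2) 0) z = - bil (VV 2 0) z := by rw [← bil_neg_left, neg_VV]; rfl
  have n5 : bil (VV (-1) (-1)) z = - bil (VV 1 1) z := by rw [← bil_neg_left, neg_VV]
  have n6 : bil (VV 1 (-1)) z = - bil (VV (-1) 1) z := by rw [← bil_neg_left, neg_VV]; rfl
  rw [twoG2_VV] at hτ
  simp only [List.mem_cons, List.not_mem_nil, or_false] at hτ
  rcases hτ with rfl | rfl | rfl | rfl | rfl | rfl | rfl | rfl | rfl | rfl | rfl | rfl <;>
  · simp only [lead, half_VV, twoShort_VV, VV_inj, List.mem_cons, List.not_mem_nil, multSum,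
      G2plus, shortRoots, longRoots, a1, a2, a3, b1, b2, b3, neg_VV, bil_VV,
      List.filter_cons, List.filter_nil]
    norm_num [n1, n2, n3, n4, n5, n6, bil_VV, VV_inj]
    try ring

theorem odd_sum (F : (Fin 2 → ℂ) → ℂ) (hF : ∀ τ, F (-τ) = - F τ) :
    (twoG2.map F).sum = 0 := by
  simp only [twoG2, G2all, longRoots, shortRoots, List.map_cons, List.map_nil, List.cons_append,
    List.nil_append, List.sum_cons, List.sum_nil, smul_neg, hF]
  ring

theorem kap_neg (τ : Fin 2 → ℂ) : kap (-τ) = kap τ := by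
  have : -τ ∈ twoShort ↔ τ ∈ twoShort := by
    simp only [twoShort, shortRoots, List.map_cons, List.map_nil, List.mem_cons,
      List.not_mem_nil, or_false, smul_neg, neg_inj, neg_eq_iff_eq_neg, neg_neg]
    tauto
  unfold kap
  simp only [this]

theorem sum_lin (L : List (Fin 2 → ℂ)) (w c d : (Fin 2 → ℂ) → ℂ) :
    (L.map (fun τ => w τ * (G2plus.map (fun γ => c γ * (bil τ γ / d γ))).sum)).sum
      = (G2plus.map (fun γ => c γ * (L.map (fun τ => bil τ γ * w τ)).sum / d γ)).sum := by
  induction L with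
  | nil => simp [G2plus]
  | cons a L ih =>
    rw [List.map_cons, List.sum_cons, ih]
    simp only [G2plus, List.map_cons, List.map_nil, List.sum_cons, List.sum_nil]
    ring

/-- The effect of one application of `D₁ − μ(x)` to a
function `A(z)·exp⟨x,z⟩` with `A(z) = ∏_{γ∈G₂₊} ⟨γ,z⟩^{n_γ}`. -/
theorem stmt_11 (m : ℕ) (hm : 1 ≤ m) (x : Fin 2 → ℂ)
    (nγ : (Fin 2 → ℂ) → ℕ) (N : ℕ) (hN : N = (G2plus.map nγ).sum)
    (A : (Fin 2 → ℂ) → ℂ)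
    (hA : ∀ z, A z = (G2plus.map (fun γ => bil γ z ^ nγ γ)).prod) :
    ∃ u v : MvPolynomial (Fin 2) ℂ, v ≠ 0 ∧
      u.totalDegree + 2 ≤ v.totalDegree + N ∧
      ∀ z : Fin 2 → ℂ, D1Reg z → MvPolynomial.eval z v ≠ 0 →
        (∀ γ ∈ G2plus, bil γ z ≠ 0) →
        (twoG2.map (fun τ =>
            aD1 m τ z * (A (z + τ) * Complex.exp (bil x τ) - A z))).sum
          - muD1 x * A z
        = (G2plus.map (fun γ =>
            ((nγ γ : ℂ) - (multSum m γ : ℂ)) * cSum x γ * A z / bil γ z)).sum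
          + MvPolynomial.eval z u / MvPolynomial.eval z v := by
  classical
  choose! p hp hpl using aD1_PE m
  set B : (Fin 2 → ℂ) → (Fin 2 → ℂ) → ℂ := fun τ z =>
    (G2plus.map (fun γ => (1 + bil τ γ / (bil γ z + 0)) ^ nγ γ)).prod with hB
  set lB : (Fin 2 → ℂ) → (Fin 2 → ℂ) → ℂ := fun τ z =>
    (G2plus.map (fun γ => (nγ γ : ℂ) * (bil τ γ / bil γ z))).sum with hlB
  have hBl : ∀ τ, PE (B τ) (lB τ) := fun τ =>
    PE.list G2plus _ _ (fun γ hγ => (PE.fac γ (G2plus_ne γ hγ) (bil τ γ) 0).pow (nγ γ))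
  set T : (Fin 2 → ℂ) → (Fin 2 → ℂ) → ℂ := fun τ z =>
    kap τ * (Complex.exp (bil x τ) * (p τ z * B τ z - 1 - (lead m τ z + lB τ z))
      + (-1) * (p τ z - 1 - lead m τ z)) with hT
  have hTR : ∀ τ ∈ twoG2, RO (-2) (T τ) := fun τ hτ =>
    ((((hpl τ hτ).mul (hBl τ)).2.smul _).add ((hpl τ hτ).2.smul _)).smul _
  have hAR : RO N A := by
    have := RO.list_pow G2plus nγ
    rw [← hN] at this
    exact this.of_eq hA
  obtain ⟨u, v, hv, hd, he⟩ := hAR.mul (RO.list_sum twoG2 T hTR)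
  refine ⟨u, v, hv, by omega, fun z _ hvz hz => ?_⟩
  rw [← he z hvz]
  have hAB : ∀ τ, A (z + τ) = A z * B τ z := by
    intro τ
    have : ∀ γ ∈ G2plus, bil γ (z + τ) ^ nγ γ
        = bil γ z ^ nγ γ * (1 + bil τ γ / (bil γ z + 0)) ^ nγ γ := by
      intro γ hγ
      rw [← mul_pow, bil_add_right, add_zero, mul_add, mul_div_cancel₀ _ (hz γ hγ), mul_one]
      congr 2
      simp only [bil]
      ring
    rw [hA, hA, hB, List.map_congr_left this]
    exact List.prod_map_mul
  have key : ∀ τ ∈ twoG2, aD1 m τ z * (A (z + τ) * Complex.exp (bil x τ) - A z)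
      = ((A z * T τ z + A z * (kap τ * (Complex.exp (bil x τ) - 1)))
        + A z * ((kap τ * Complex.exp (bil x τ)) * (G2plus.map (fun γ =>
            ((nγ γ : ℂ) - (multSum m γ : ℂ)) * (bil τ γ / bil γ z))).sum))
        + A z * (kap τ * (G2plus.map (fun γ =>
            (multSum m γ : ℂ) * (bil τ γ / bil γ z))).sum) := by
    intro τ hτ
    rw [hp τ hτ z, hAB τ]
    simp only [hT, lead_eq m τ hτ z, hlB]
    have : (G2plus.map (fun γ =>
            ((nγ γ : ℂ) - (multSum m γ : ℂ)) * (bil τ γ / bil γ z))).sum =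
        (G2plus.map (fun γ => (nγ γ : ℂ) * (bil τ γ / bil γ z))).sum -
        (G2plus.map (fun γ => (multSum m γ : ℂ) * (bil τ γ / bil γ z))).sum := by
      simp only [G2plus, List.map_cons, List.map_nil, List.sum_cons, List.sum_nil]
      ring
    rw [this]
    ring
  have hodd : (twoG2.map (fun τ => kap τ * (G2plus.map (fun γ =>
            (multSum m γ : ℂ) * (bil τ γ / bil γ z))).sum)).sum = 0 := by
    apply odd_sum
    intro τ
    simp only [kap_neg, bil_neg_left, G2plus, List.map_cons, List.map_nil, List.sum_cons,
      List.sum_nil]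
    ring
  rw [List.map_congr_left key, List.sum_map_add, List.sum_map_add, List.sum_map_add,
    List.sum_map_mul_left, List.sum_map_mul_left, List.sum_map_mul_left, List.sum_map_mul_left,
    hodd, sum_lin]
  have hc : ∀ γ, (twoG2.map (fun τ => bil τ γ * (kap τ * Complex.exp (bil x τ)))).sum
      = cSum x γ := by
    intro γ
    unfold cSum
    congr 1
    apply List.map_congr_left
    intro τ _
    ring
  simp only [hc]
  have hmu : (twoG2.map (fun τ => kap τ * (Complex.exp (bil x τ) - 1))).sum = muD1 x := rfl
  rw [hmu]
  have : ∀ γ ∈ G2plus, A z * (((nγ γ : ℂ) - (multSum m γ : ℂ)) * cSum x γ / bil γ z)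
      = ((nγ γ : ℂ) - (multSum m γ : ℂ)) * cSum x γ * A z / bil γ z := by
    intro γ _
    ring
  rw [← List.map_congr_left this, List.sum_map_mul_left]
  ring
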